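/- Let 𝒞₁₆ ⊆ 𝔽₂¹⁶ be the 𝔽₂-span of the 11 vectors (1,0,0,0,0,0,0,1,0,0,0,1,0,1,1,1), (0,1,0,0,0,0,0,1,0,0,0,1,0,1,0,0), (0,0,1,0,0,0,0,1,0,0,0,1,0,0,1,0), (0,0,0,1,0,0,0,1,0,0,0,1,0,0,0,1), (0,0,0,0,1,0,0,1,0,0,0,0,0,1,1,0), (0,0,0,0,0,1,0,1,0,0,0,0,0,1,0,1), (0,0,0,0,0,0,1,1,0,0,0,0,0,0,1,1), (0,0,0,0,0,0,0,0,1,0,0,1,0,1,1,0), (0,0,0,0,0,0,0,0,0,1,0,1,0,1,0,1), (0,0,0,0,0,0,0,0,0,0,1,1,0,0,1,1), (0,0,0,0,0,0,0,0,0,0,0,0,1,1,1,1). Then every element of 𝒞₁₆ has Hamming weight in {0, 4, 6, 8, 10, 12, 16}, and the number of codewords of each weight is: weight 0: 1 codeword; weight 4: 140; weight 6: 448; weight 8: 870; weight 10: 448; weight 12: 140; weight 16: 1. In particular every nonzero codeword has Hamming weight at least 4. -/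

import Mathlib

/-- The generators of the binary code `𝒞₁₆`. -/
def C16gens : Fin 11 → Fin 16 → ZMod 2 :=
  ![![1,0,0,0,0,0,0,1,0,0,0,1,0,1,1,1],
    ![0,1,0,0,0,0,0,1,0,0,0,1,0,1,0,0],
    ![0,0,1,0,0,0,0,1,0,0,0,1,0,0,1,0],
    ![0,0,0,1,0,0,0,1,0,0,0,1,0,0,0,1],
    ![0,0,0,0,1,0,0,1,0,0,0,0,0,1,1,0],
    ![0,0,0,0,0,1,0,1,0,0,0,0,0,1,0,1],
    ![0,0,0,0,0,0,1,1,0,0,0,0,0,0,1,1],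
    ![0,0,0,0,0,0,0,0,1,0,0,1,0,1,1,0],
    ![0,0,0,0,0,0,0,0,0,1,0,1,0,1,0,1],
    ![0,0,0,0,0,0,0,0,0,0,1,1,0,0,1,1],
    ![0,0,0,0,0,0,0,0,0,0,0,0,1,1,1,1]]

/-- The binary vector of length 16 whose coordinates are the binary digits of `n`,
most significant first. -/
def bitVector (n : ℕ) (i : Fin 16) : ZMod 2 := if n.testBit (15 - i) then 1 else 0

/-- All sums modulo 2 (bitwise exclusive or) of subfamilies of a list of words. -/
def xorSpan : List ℕ → List ℕ
  | [] => [0]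
  | g :: gs => xorSpan gs ++ (xorSpan gs).map (g ^^^ ·)

/-- The number of ones among the last `k` binary digits of `n`. -/
def bitCount : ℕ → ℕ → ℕ
  | 0, _ => 0
  | k + 1, n => n % 2 + bitCount k (n / 2)

/-- The rows of the generator matrix of `𝒞₁₆`, read as binary numerals. -/
def C16rows : List ℕ :=
  [33047, 16660, 8466, 4369, 2310, 1285, 771, 150, 85, 51, 15]

/-- The number of elements `n` of `xorSpan gs` (with multiplicity) for which `a ^^^ n`
satisfies `p`, computed by a binary recursion whose depth is the length of `gs`. -/
def xorCount (p : ℕ → Bool) : List ℕ → ℕ → ℕ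
  | [], a => if p a then 1 else 0
  | g :: gs, a => xorCount p gs a + xorCount p gs (a ^^^ g)

theorem bitVector_zero : bitVector 0 = 0 := by
  ext i
  simp [bitVector]

theorem bitVector_xor (m n : ℕ) : bitVector (m ^^^ n) = bitVector m + bitVector n := by
  funext i
  simp only [bitVector, Pi.add_apply, Nat.testBit_xor]
  cases m.testBit (15 - i) <;> cases n.testBit (15 - i) <;> decide

theorem bitVector_injOn : Set.InjOn bitVector {n | n < 2 ^ 16} := by
  intro m hm n hn h
  refine Nat.eq_of_testBit_eq fun j => ?_
  by_cases hj : j < 16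
  · have hji := congrFun h ⟨15 - j, by omega⟩
    have hsub : 15 - (15 - j) = j := by omega
    simp only [bitVector, hsub] at hji
    cases hmj : m.testBit j <;> cases hnj : n.testBit j <;> simp_all
  · have hpow : 2 ^ 16 ≤ 2 ^ j := Nat.pow_le_pow_right (by norm_num) (by omega)
    rw [Nat.testBit_lt_two_pow (lt_of_lt_of_le hm hpow),
      Nat.testBit_lt_two_pow (lt_of_lt_of_le hn hpow)]

theorem bitCount_eq_sum_testBit (k n : ℕ) :
    bitCount k n = ∑ j ∈ Finset.range k, if n.testBit j then 1 else 0 := by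
  induction k generalizing n with
  | zero => rfl
  | succ k ih =>
    rw [bitCount, ih, Finset.sum_range_succ', add_comm]
    simp only [Nat.testBit_add_one, Nat.testBit_zero]
    rcases Nat.mod_two_eq_zero_or_one n with h | h <;> simp [h]

theorem card_filter_bitVector_ne_zero (n : ℕ) :
    (Finset.univ.filter fun i => bitVector n i ≠ 0).card = bitCount 16 n := by
  have hne : ∀ i : Fin 16, bitVector n i ≠ 0 ↔ n.testBit (15 - i) = true := by
    intro i
    simp [bitVector]
  simp only [hne, Finset.card_filter]
  rw [Fin.sum_univ_eq_sum_range (fun i => if n.testBit (15 - i) = true then 1 else 0) 16,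
    bitCount_eq_sum_testBit]
  exact Finset.sum_range_reflect (fun j => if n.testBit j = true then 1 else 0) 16

theorem mem_span_bitVector_iff (gs : List ℕ) (x : Fin 16 → ZMod 2) :
    x ∈ Submodule.span (ZMod 2) (bitVector '' {g | g ∈ gs}) ↔
      ∃ n ∈ xorSpan gs, bitVector n = x := by
  induction gs generalizing x with
  | nil => simp [xorSpan, bitVector_zero, eq_comm]
  | cons g gs ih =>
    have hset : {a | a ∈ g :: gs} = insert g {a | a ∈ gs} := by
      ext a
      simp
    rw [hset, Set.image_insert_eq, Submodule.mem_span_insert]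
    simp only [xorSpan, List.mem_append, List.mem_map]
    constructor
    · rintro ⟨a, z, hz, rfl⟩
      obtain ⟨n, hn, rfl⟩ := (ih z).1 hz
      have ha : a = 0 ∨ a = 1 := by
        revert a
        decide
      rcases ha with rfl | rfl
      · exact ⟨n, Or.inl hn, by simp⟩
      · exact ⟨g ^^^ n, Or.inr ⟨n, hn, rfl⟩, by simp [bitVector_xor]⟩
    · rintro ⟨n, hn | ⟨m, hm, rfl⟩, rfl⟩
      · exact ⟨0, bitVector n, (ih _).2 ⟨n, hn, rfl⟩, by simp⟩
      · exact ⟨1, bitVector m, (ih _).2 ⟨m, hm, rfl⟩, by simp [bitVector_xor]⟩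

theorem countP_xor_xorSpan (p : ℕ → Bool) (gs : List ℕ) (a : ℕ) :
    (xorSpan gs).countP (fun n => p (a ^^^ n)) = xorCount p gs a := by
  induction gs generalizing a with
  | nil => simp [xorSpan, xorCount]
  | cons g gs ih =>
    rw [xorSpan, xorCount, List.countP_append, List.countP_map, ih, ← ih (a ^^^ g)]
    simp only [Function.comp_def, Nat.xor_assoc]

theorem countP_xorSpan (p : ℕ → Bool) (gs : List ℕ) :
    (xorSpan gs).countP p = xorCount p gs 0 := by
  simpa using countP_xor_xorSpan p gs 0

theorem lt_two_pow_of_mem_xorSpan {k : ℕ} {gs : List ℕ} (h : ∀ g ∈ gs, g < 2 ^ k) :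
    ∀ n ∈ xorSpan gs, n < 2 ^ k := by
  induction gs with
  | nil => simp [xorSpan]
  | cons g gs ih =>
    have ih' := ih fun a ha => h a (List.mem_cons_of_mem g ha)
    simp only [xorSpan, List.mem_append, List.mem_map]
    rintro n (hn | ⟨m, hm, rfl⟩)
    · exact ih' n hn
    · exact Nat.xor_lt_two_pow (h g List.mem_cons_self) (ih' m hm)

theorem nodup_xorSpan {gs : List ℕ} (h0 : ∀ g ∈ gs, 0 < g.size)
    (h : gs.Pairwise fun a b => b.size < a.size) : (xorSpan gs).Nodup := by
  induction gs with
  | nil => simp [xorSpan]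
  | cons g gs ih =>
    rw [List.pairwise_cons] at h
    have ih' := ih (fun a ha => h0 a (List.mem_cons_of_mem g ha)) h.2
    have hg : 0 < g.size := h0 g List.mem_cons_self
    have hle : 2 ^ (g.size - 1) ≤ g := Nat.lt_size.1 (by omega)
    have hlt : ∀ n ∈ xorSpan gs, n < 2 ^ (g.size - 1) :=
      lt_two_pow_of_mem_xorSpan fun a ha => Nat.size_le.1 (by have := h.1 a ha; omega)
    refine List.nodup_append'.2 ⟨ih', ih'.map fun a b hab => Nat.xor_right_injective hab, ?_⟩
    intro n hn hn'
    obtain ⟨m, hm, rfl⟩ := List.mem_map.1 hn'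
    have hxor := Nat.xor_lt_two_pow (hlt _ hn) (hlt m hm)
    rw [Nat.xor_assoc, Nat.xor_self, Nat.xor_zero] at hxor
    omega

theorem range_C16gens : Set.range C16gens = bitVector '' {g | g ∈ C16rows} := by
  have hrow : ∀ i : Fin 11, C16gens i = bitVector (C16rows.get i) := by decide +kernel
  ext x
  constructor
  · rintro ⟨i, rfl⟩
    exact ⟨C16rows.get i, List.get_mem _ _, (hrow i).symm⟩
  · rintro ⟨g, hg, rfl⟩
    obtain ⟨i, rfl⟩ := List.get_of_mem hg
    exact ⟨i, hrow i⟩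

theorem mem_span_C16gens_iff (x : Fin 16 → ZMod 2) :
    x ∈ Submodule.span (ZMod 2) (Set.range C16gens) ↔
      ∃ n ∈ xorSpan C16rows, bitVector n = x := by
  rw [range_C16gens, mem_span_bitVector_iff]

theorem nodup_xorSpan_C16rows : (xorSpan C16rows).Nodup :=
  nodup_xorSpan (by decide +kernel) (by decide +kernel)

theorem lt_of_mem_xorSpan_C16rows : ∀ n ∈ xorSpan C16rows, n < 2 ^ 16 :=
  lt_two_pow_of_mem_xorSpan (by decide +kernel)

theorem bitCount_mem_of_mem_xorSpan_C16rows :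
    ∀ n ∈ xorSpan C16rows, bitCount 16 n ∈ [0, 4, 6, 8, 10, 12, 16] := by
  have hcount : (xorSpan C16rows).countP
      (fun n => decide (bitCount 16 n ∉ [0, 4, 6, 8, 10, 12, 16])) = 0 := by
    rw [countP_xorSpan]
    decide +kernel
  simpa only [decide_eq_true_eq, not_not] using List.countP_eq_zero.1 hcount

theorem card_span_C16gens_of_weight (w : ℕ) :
    Nat.card {x : Fin 16 → ZMod 2 // x ∈ Submodule.span (ZMod 2) (Set.range C16gens) ∧
      (Finset.univ.filter fun i => x i ≠ 0).card = w} =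
      xorCount (bitCount 16 · == w) C16rows 0 := by
  have hnodup : (((xorSpan C16rows).filter (bitCount 16 · == w)).map bitVector).Nodup := by
    refine List.Nodup.map_on ?_ (nodup_xorSpan_C16rows.filter _)
    intro m hm n hn h
    exact bitVector_injOn (lt_of_mem_xorSpan_C16rows m (List.mem_of_mem_filter hm))
      (lt_of_mem_xorSpan_C16rows n (List.mem_of_mem_filter hn)) h
  rw [← countP_xorSpan, List.countP_eq_length_filter,
    ← List.length_map (f := bitVector), ← List.toFinset_card_of_nodup hnodup]
  refine Nat.subtype_card _ fun x => ?_
  rw [mem_span_C16gens_iff]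
  simp only [List.mem_toFinset, List.mem_map, List.mem_filter, beq_iff_eq]
  constructor
  · rintro ⟨n, ⟨hn, hw⟩, rfl⟩
    exact ⟨⟨n, hn, rfl⟩, by rw [card_filter_bitVector_ne_zero, hw]⟩
  · rintro ⟨⟨n, hn, rfl⟩, hw⟩
    exact ⟨n, ⟨hn, by rw [← hw, card_filter_bitVector_ne_zero]⟩, rfl⟩

theorem stmt_10 :
    let C : Submodule (ZMod 2) (Fin 16 → ZMod 2) :=
      Submodule.span (ZMod 2) (Set.range C16gens)
    let wt : (Fin 16 → ZMod 2) → ℕ := fun x => (Finset.univ.filter fun i => x i ≠ 0).card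
    (∀ x ∈ C, wt x ∈ ({0, 4, 6, 8, 10, 12, 16} : Set ℕ)) ∧
    Nat.card {x : Fin 16 → ZMod 2 // x ∈ C ∧ wt x = 0} = 1 ∧
    Nat.card {x : Fin 16 → ZMod 2 // x ∈ C ∧ wt x = 4} = 140 ∧
    Nat.card {x : Fin 16 → ZMod 2 // x ∈ C ∧ wt x = 6} = 448 ∧
    Nat.card {x : Fin 16 → ZMod 2 // x ∈ C ∧ wt x = 8} = 870 ∧
    Nat.card {x : Fin 16 → ZMod 2 // x ∈ C ∧ wt x = 10} = 448 ∧
    Nat.card {x : Fin 16 → ZMod 2 // x ∈ C ∧ wt x = 12} = 140 ∧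
    Nat.card {x : Fin 16 → ZMod 2 // x ∈ C ∧ wt x = 16} = 1 ∧
    (∀ x ∈ C, x ≠ 0 → 4 ≤ wt x) := by
  intro C wt
  have hwt : ∀ x ∈ C, wt x ∈ [0, 4, 6, 8, 10, 12, 16] := by
    intro x hx
    obtain ⟨n, hn, rfl⟩ := (mem_span_C16gens_iff x).1 hx
    have hcount : wt (bitVector n) = bitCount 16 n := card_filter_bitVector_ne_zero n
    rw [hcount]
    exact bitCount_mem_of_mem_xorSpan_C16rows n hn
  refine ⟨fun x hx => by simpa using hwt x hx,
    (card_span_C16gens_of_weight 0).trans (by decide +kernel),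
    (card_span_C16gens_of_weight 4).trans (by decide +kernel),
    (card_span_C16gens_of_weight 6).trans (by decide +kernel),
    (card_span_C16gens_of_weight 8).trans (by decide +kernel),
    (card_span_C16gens_of_weight 10).trans (by decide +kernel),
    (card_span_C16gens_of_weight 12).trans (by decide +kernel),
    (card_span_C16gens_of_weight 16).trans (by decide +kernel), fun x hx hx0 => ?_⟩
  have hpos : 0 < wt x := by
    obtain ⟨i, hi⟩ := Function.ne_iff.1 hx0
    exact Finset.card_pos.2 ⟨i, Finset.mem_filter.2 ⟨Finset.mem_univ i, hi⟩⟩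
  have hmem := hwt x hx
  simp only [List.mem_cons, List.not_mem_nil, or_false] at hmem
  omega
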